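/- Let a : ℤ × ℤ → K be admissible and satisfy the cocycle recurrence, and let k ≥ 4 be an integer such that a(3,j) = 0 for all j with 4 ≤ j < k, a(3,k) ≠ 0, and M_{−1}(a)(2,3,k) = 0. Then a(3,k+1) ≠ 0. -/

import Mathlib

/-- `a : ℤ × ℤ → K` (curried) is admissible: antisymmetric, and vanishing whenever
one of the indices is `≤ 1`. -/
def IsAdmissible {K : Type*} [Field K] (a : ℤ → ℤ → K) : Prop :=
  (∀ i j : ℤ, a j i = -a i j) ∧ (∀ i j : ℤ, i ≤ 1 ∨ j ≤ 1 → a i j = 0)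

/-- `a` satisfies the cocycle recurrence `a (i+1) j + a i (j+1) = a i j` for `i, j ≥ 2`. -/
def CocycleRec {K : Type*} [Field K] (a : ℤ → ℤ → K) : Prop :=
  ∀ i j : ℤ, 2 ≤ i → 2 ≤ j → a (i + 1) j + a i (j + 1) = a i j

/-- The weight-`l` Massey square of `a`. -/
def MasseySq {K : Type*} [Field K] (l : ℤ) (a : ℤ → ℤ → K) (i j k : ℤ) : K :=
  a i j * a (i + j + l) k + a j k * a (j + k + l) i + a k i * a (k + i + l) j

/-- Auxiliary for the `m`-family: its values on pairs `(i,j)` with `2 ≤ i < j`. -/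
def famAux (K : Type*) [Field K] (m i j : ℤ) : K :=
  if 2 ≤ i ∧ i < j ∧ i ≤ m ∧ m + 1 ≤ j then
    (-1 : K) ^ (m - i).toNat * ((j - m - 1).toNat.choose (m - i).toNat : K)
  else 0

/-- The `m`-family `F_m`: for `2 ≤ i < j`, `F_m(i,j) = (-1)^(m-i) * C(j-m-1, m-i)` if
`i ≤ m` and `j ≥ m+1`, and `0` otherwise; extended antisymmetrically, and `0` when an
index is `≤ 1`. -/
def Fam (K : Type*) [Field K] (m i j : ℤ) : K := famAux K m i j - famAux K m j i

/-- If the row `a 3` vanishes on `[4, k)`, then the row `a 2` is constant on `[3, k]`. -/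
theorem CocycleRec.two_row_eq {K : Type*} [Field K] [CharZero K] {a : ℤ → ℤ → K}
    (ha : IsAdmissible a)
    (hrec : CocycleRec a) {k : ℤ} (hk : 4 ≤ k) (hzero : ∀ j : ℤ, 4 ≤ j → j < k → a 3 j = 0) :
    a 2 k = a 2 3 := by
  induction k, hk using Int.leInduction with
  | base =>
    have h33 : a 3 3 = 0 :=
      self_eq_neg.mp (ha.1 3 3)
    have h := hrec 2 3 le_rfl (by norm_num)
    norm_num at h
    rwa [h33, zero_add] at h
  | succ n hn ih =>
    have h := hrec 2 n le_rfl (by lia)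
    norm_num at h
    rw [hzero n hn (by lia), zero_add] at h
    rw [h, ih fun j hj hjn => hzero j hj (by lia)]

/-- If `a` is admissible, satisfies the cocycle recurrence, `k ≥ 4` is such that
`a 3 j = 0` for `4 ≤ j < k`, `a 3 k ≠ 0`, and the weight-`(-1)` Massey square
`M(2,3,k)` vanishes, then `a 3 (k+1) ≠ 0`. -/
theorem three_column_nonzero_propagates (K : Type*) [Field K] [CharZero K]
    (a : ℤ → ℤ → K) (ha : IsAdmissible a) (hrec : CocycleRec a)
    (k : ℤ) (hk : 4 ≤ k) (hzero : ∀ j : ℤ, 4 ≤ j → j < k → a 3 j = 0)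
    (hne : a 3 k ≠ 0) (hM : MasseySq (-1) a 2 3 k = 0) :
    a 3 (k + 1) ≠ 0 := by
  intro hk1
  have h2k := hrec.two_row_eq ha hk hzero
  have h1 := hrec 2 k le_rfl (by lia)
  have h2 := hrec 2 (k + 1) le_rfl (by lia)
  have h3 := hrec 3 k (by norm_num) (by lia)
  rw [add_assoc k 1 1] at h2
  norm_num at h1 h2 h3
  have e : k + 2 = 3 + k + -1 := by ring
  have e' : k + 1 = k + 2 + -1 := by ring
  have hsq : a 3 k ^ 2 = 0 := by
    unfold MasseySq at hM
    rw [← e, ← e', ha.1 2 (k + 2), ha.1 3 (k + 1), hk1, show (2 + 3 + -1 : ℤ) = 4 by norm_num]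
      at hM
    linear_combination hM - a 2 3 * h3 + a 3 k * (h1 + h2k + h2) + (a 2 3 - a 3 k) * hk1
  exact hne (pow_eq_zero_iff two_ne_zero |>.mp hsq)
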